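/- Let X be the simple random walk on a connected simple graph G with n ≥ 2 vertices, and let x and y be any two vertices. Then for all integers t > 0, P_x(τ(y) = t) ≤ (4e · log n)/t, and consequently P_x(S_t) ≤ (4e · n log n)/t. -/

import Mathlib

open Finset

/-- A (row-)stochastic transition matrix: the transition kernel of a Markov chain
on the finite state space `S`. -/
def IsStochastic {S : Type*} [Fintype S] (p : Matrix S S ℝ) : Prop :=
  (∀ a b, 0 ≤ p a b) ∧ ∀ a, ∑ b, p a b = 1

/-- The probability weight of a finite trajectory `z 0, z 1, …, z m` of the chain. -/
noncomputable def pathWeight {S : Type*} (p : Matrix S S ℝ) {m : ℕ} (z : Fin (m + 1) → S) : ℝ :=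
  ∏ i : Fin m, p (z i.castSucc) (z i.succ)

open scoped Classical in
/-- `P_x(A)` for an event `A` depending on the trajectory `X_0, X_1, …, X_m`
of the chain started at `x`. -/
noncomputable def eventProb {S : Type*} [Fintype S] (p : Matrix S S ℝ) (x : S) (m : ℕ)
    (A : (Fin (m + 1) → S) → Prop) : ℝ :=
  ∑ z : Fin (m + 1) → S, if z 0 = x ∧ A z then pathWeight p z else 0

/-- `P_x(τ(y) = t)`: the probability that the chain started at `x` first visits `y`
exactly at time `t`. -/
noncomputable def hitProbEq {S : Type*} [Fintype S] (p : Matrix S S ℝ) (x y : S) (t : ℕ) : ℝ :=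
  eventProb p x t fun z => z (Fin.last t) = y ∧ ∀ i : Fin (t + 1), (i : ℕ) < t → z i ≠ y

/-- `P_x(S_t)`: the probability that the state visited at time `t` was not visited
at any earlier time. -/
noncomputable def surpriseProb {S : Type*} [Fintype S] (p : Matrix S S ℝ) (x : S) (t : ℕ) : ℝ :=
  eventProb p x t fun z => ∀ i : Fin (t + 1), (i : ℕ) < t → z i ≠ z (Fin.last t)

open scoped Classical in
/-- The transition matrix of the simple random walk on a graph `G`: from a vertex,
move to a uniformly random neighbor. -/
noncomputable def walkMatrix {V : Type*} [Fintype V] (G : SimpleGraph V) : Matrix V V ℝ :=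
  Matrix.of fun a b => if G.Adj a b then (1 : ℝ) / (Nat.card (G.neighborSet a)) else 0


section aux

open scoped Classical

variable {S : Type*} [Fintype S]

/-- First-hitting probabilities defined recursively. -/
noncomputable def hitRec (p : Matrix S S ℝ) (y : S) : ℕ → S → ℝ
  | 0, z => if z = y then 1 else 0
  | t + 1, z => if z = y then 0 else ∑ w, p z w * hitRec p y t w

lemma eventProb_succ (p : Matrix S S ℝ) (x : S) (m : ℕ) (A : (Fin (m + 2) → S) → Prop) :
    eventProb p x (m + 1) A
      = ∑ w, p x w * eventProb p w m (fun z => A (Fin.cons x z)) := by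
  unfold eventProb
  rw [← (Fin.consEquiv (fun _ : Fin (m + 2) => S)).sum_comp, Fintype.sum_prod_type]
  simp only [Finset.mul_sum]
  rw [Finset.sum_eq_single x, Finset.sum_comm]
  · refine Finset.sum_congr rfl fun z _ => ?_
    rw [Finset.sum_eq_single (z 0)]
    · have : pathWeight p (Fin.cons x z : Fin (m + 2) → S) = p x (z 0) * pathWeight p z := by
        unfold pathWeight
        rw [Fin.prod_univ_succ]
        simp [← Fin.succ_castSucc]
      by_cases hA : A (Fin.cons x z)
      · simpa [Fin.consEquiv, hA] using this
      · simp [Fin.consEquiv, hA]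
    · intro b _ hb
      simp [hb.symm]
    · simp
  · intro b _ hb
    refine Finset.sum_eq_zero fun z _ => ?_
    simp [Fin.consEquiv, hb]
  · simp

lemma hitProbEq_eq (p : Matrix S S ℝ) (y : S) (t : ℕ) (x : S) :
    hitProbEq p x y t = hitRec p y t x := by
  induction t generalizing x with
  | zero =>
    unfold hitProbEq eventProb hitRec pathWeight
    rw [← (Equiv.funUnique (Fin 1) S).symm.sum_comp]
    rw [Finset.sum_eq_single x]
    · simp
    · intro b _ hb
      simp [hb]
    · simp
  | succ t ih =>
    rw [hitProbEq, eventProb_succ, hitRec]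
    split_ifs with h
    · refine Finset.sum_eq_zero fun w _ => ?_
      unfold eventProb
      rw [Finset.sum_eq_zero, mul_zero]
      intro z _
      rw [if_neg]
      rintro ⟨_, _, h2⟩
      exact h2 0 (by simp) (by simpa using h)
    · refine Finset.sum_congr rfl fun w _ => ?_
      rw [← ih w, hitProbEq]
      congr 2
      funext z
      apply propext
      rw [← Fin.succ_last, Fin.cons_succ]
      refine and_congr_right fun _ => ?_
      rw [Fin.forall_fin_succ]
      simp [h]

lemma surprise_le (p : Matrix S S ℝ) (x : S) (t : ℕ) :
    surpriseProb p x t = ∑ y, hitProbEq p x y t := by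
  unfold surpriseProb hitProbEq eventProb
  rw [Finset.sum_comm]
  refine Finset.sum_congr rfl fun z _ => ?_
  rw [Finset.sum_eq_single (z (Fin.last t))]
  · simp
  · intro b _ hb
    rw [if_neg]
    rintro ⟨_, h, _⟩
    exact hb h.symm
  · simp

lemma hitRec_nonneg {p : Matrix S S ℝ} (hp : IsStochastic p) (y : S) (t : ℕ) (z : S) :
    0 ≤ hitRec p y t z := by
  induction t generalizing z with
  | zero => unfold hitRec; split_ifs <;> norm_num
  | succ t ih =>
    unfold hitRec; split_ifs
    · exact le_rfl
    · exact Finset.sum_nonneg fun w _ => mul_nonneg (hp.1 _ _) (ih w)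

lemma hitRec_sum_le {p : Matrix S S ℝ} (hp : IsStochastic p) (y : S) (t : ℕ) (z : S) :
    ∑ r ∈ range (t + 1), hitRec p y r z ≤ 1 := by
  induction t generalizing z with
  | zero => simp [hitRec]; split_ifs <;> norm_num
  | succ t ih =>
    rw [Finset.sum_range_succ']
    by_cases h : z = y
    · simp [hitRec, h]
    · simp only [hitRec, h, if_false, add_zero]
      rw [Finset.sum_comm]
      calc _ = ∑ w, p z w * ∑ r ∈ range (t + 1), hitRec p y r w := by
            simp only [Finset.mul_sum]
        _ ≤ ∑ w, p z w * 1 :=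
            Finset.sum_le_sum fun w _ => mul_le_mul_of_nonneg_left (ih w) (hp.1 _ _)
        _ = 1 := by simp [hp.2]

lemma pow_nonneg' {p : Matrix S S ℝ} (hp : IsStochastic p) (s : ℕ) (a b : S) :
    0 ≤ (p ^ s) a b := by
  induction s generalizing a b with
  | zero => simp [Matrix.one_apply]; split_ifs <;> norm_num
  | succ s ih =>
    rw [pow_succ, Matrix.mul_apply]
    exact Finset.sum_nonneg fun w _ => mul_nonneg (ih _ _) (hp.1 _ _)

lemma hitRec_le_pow {p : Matrix S S ℝ} (hp : IsStochastic p) (y : S) (s r : ℕ) (x : S) :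
    hitRec p y (r + s) x ≤ ∑ z, (p ^ s) x z * hitRec p y r z := by
  induction s generalizing r with
  | zero => simp [Matrix.one_apply]
  | succ s ih =>
    have h1 := ih (r + 1)
    rw [show r + 1 + s = r + (s + 1) by ring] at h1
    refine h1.trans ?_
    calc _ ≤ ∑ z, (p ^ s) x z * ∑ w, p z w * hitRec p y r w := by
          refine Finset.sum_le_sum fun z _ => mul_le_mul_of_nonneg_left ?_ (pow_nonneg' hp _ _ _)
          rw [hitRec]; split_ifs
          · exact Finset.sum_nonneg fun w _ => mul_nonneg (hp.1 _ _) (hitRec_nonneg hp _ _ _)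
          · exact le_rfl
      _ = _ := by
          simp only [pow_succ, Matrix.mul_apply, Finset.mul_sum, Finset.sum_mul]
          rw [Finset.sum_comm]
          simp only [mul_assoc]

/-- `t P(τ = t) ≤ ∑ M` for every dominating function `M`. -/
lemma mul_hitRec_le {p : Matrix S S ℝ} (hp : IsStochastic p) (x y : S) (t : ℕ) (M : S → ℝ)
    (hM : ∀ s < t, ∀ z, (p ^ s) x z ≤ M z) (hM0 : ∀ z, 0 ≤ M z) :
    t * hitRec p y t x ≤ ∑ z, M z := by
  calc (t : ℝ) * hitRec p y t x = ∑ s ∈ range t, hitRec p y t x := by simp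
    _ ≤ ∑ s ∈ range t, ∑ z, M z * hitRec p y (t - s) z := by
        refine Finset.sum_le_sum fun s hs => ?_
        have hs' := Finset.mem_range.1 hs
        have := hitRec_le_pow hp y s (t - s) x
        rw [Nat.sub_add_cancel hs'.le] at this
        refine this.trans (Finset.sum_le_sum fun z _ => ?_)
        exact mul_le_mul_of_nonneg_right (hM s hs' z) (hitRec_nonneg hp _ _ _)
    _ = ∑ z, M z * ∑ s ∈ range t, hitRec p y (t - s) z := by
        rw [Finset.sum_comm]; simp only [Finset.mul_sum]
    _ ≤ ∑ z, M z * 1 := by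
        refine Finset.sum_le_sum fun z _ => mul_le_mul_of_nonneg_left ?_ (hM0 z)
        refine le_trans ?_ (hitRec_sum_le hp y t z)
        rw [Finset.sum_range_succ', ← Finset.sum_range_reflect]
        refine le_trans (le_of_eq ?_) (le_add_of_nonneg_right (hitRec_nonneg hp _ _ _))
        refine Finset.sum_congr rfl fun s hs => ?_
        have hs' := Finset.mem_range.1 hs
        congr 1
        omega
    _ = _ := by simp

lemma powVec_le {p : Matrix S S ℝ} (hp : IsStochastic p) (k : ℕ) {f : S → ℝ} {B : ℝ}
    (hf : ∀ z, f z ≤ B) (z : S) : ((p ^ k).mulVec f) z ≤ B := by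
  induction k generalizing z with
  | zero => simpa using hf z
  | succ k ih =>
    rw [pow_succ', ← Matrix.mulVec_mulVec]
    calc _ ≤ ∑ w, p z w * B :=
          Finset.sum_le_sum fun w _ => mul_le_mul_of_nonneg_left (ih w) (hp.1 _ _)
      _ = B := by rw [← Finset.sum_mul, hp.2, one_mul]

lemma powVec_nonneg {p : Matrix S S ℝ} (hp : IsStochastic p) (k : ℕ) {f : S → ℝ}
    (hf : ∀ z, 0 ≤ f z) (z : S) : 0 ≤ ((p ^ k).mulVec f) z :=
  Finset.sum_nonneg fun w _ => mul_nonneg (pow_nonneg' hp _ _ _) (hf w)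

/-- Accumulated functional for the reversed martingale. -/
noncomputable def accF (p : Matrix S S ℝ) (h : S → ℝ) (a : ℕ → S → ℝ) : ℕ → S → ℝ
  | 0 => fun z => h z * a 0 z
  | k + 1 => fun z => (p.mulVec (accF p h a k)) z
      + ((p ^ (k + 1)).mulVec h) z * ((p ^ (k + 1)).mulVec (a (k + 1))) z

lemma log_key {m N B : ℝ} (hm : 0 < m) (hB : 0 < B) :
    max m N + N * Real.log (B / max m N) ≤ m + N * Real.log (B / m) := by
  rcases le_total N m with h | h
  · rw [max_eq_left h]
  · rw [max_eq_right h]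
    have hN : 0 < N := hm.trans_le h
    rw [Real.log_div hB.ne' hN.ne', Real.log_div hB.ne' hm.ne']
    have h1 : Real.log (m / N) ≤ m / N - 1 := Real.log_le_sub_one_of_pos (by positivity)
    rw [Real.log_div hm.ne' hN.ne'] at h1
    have h2 := mul_le_mul_of_nonneg_left h1 hN.le
    have h3 : N * (m / N - 1) = m - N := by field_simp
    nlinarith

lemma accF_le {p : Matrix S S ℝ} (hp : IsStochastic p) {h : S → ℝ} {B : ℝ} (hB : 0 < B)
    (h0 : ∀ z, 0 ≤ h z) (hh : ∀ z, h z ≤ B) (a : ℕ → S → ℝ) (ha : ∀ k z, 0 ≤ a k z)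
    (k : ℕ) (hs : ∀ z, ∑ j ∈ range (k + 1), a j z ≤ 1) (z : S) (m : ℝ) (hm : 0 < m)
    (hmB : m ≤ B) :
    accF p h a k z + m * ((p ^ k).mulVec (fun w => 1 - ∑ j ∈ range (k + 1), a j w)) z
      ≤ m + ((p ^ k).mulVec h) z * Real.log (B / m) := by
  induction k generalizing z m with
  | zero =>
    have hs0 : a 0 z ≤ 1 := by simpa using hs z
    have ha0 := ha 0 z
    have key := log_key (N := h z) hm hB
    simp only [accF, pow_zero, Matrix.one_mulVec, zero_add, Finset.sum_range_one]
    have h1 : 0 ≤ h z * Real.log (B / max m (h z)) :=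
      mul_nonneg (h0 z) (Real.log_nonneg (by
        rw [one_le_div (lt_max_of_lt_left hm)]; exact max_le hmB (hh z)))
    nlinarith [le_max_left m (h z), le_max_right m (h z),
      mul_le_mul_of_nonneg_left (le_max_right m (h z)) ha0,
      mul_le_mul_of_nonneg_left (le_max_left m (h z)) (sub_nonneg.2 hs0)]
  | succ k ih =>
    have hs' : ∀ z, ∑ j ∈ range (k + 1), a j z ≤ 1 := fun z =>
      le_trans (by rw [Finset.sum_range_succ _ (k + 1)]; linarith [ha (k + 1) z]) (hs z)
    set N := ((p ^ (k + 1)).mulVec h) z with hN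
    set M := max m N with hMdef
    have hM : 0 < M := lt_max_of_lt_left hm
    have hMB : M ≤ B := max_le hmB (powVec_le hp _ hh z)
    have key := log_key (N := N) hm hB
    set g : S → ℝ := fun w => 1 - ∑ j ∈ range (k + 1), a j w with hg
    set g' : S → ℝ := fun w => 1 - ∑ j ∈ range (k + 1 + 1), a j w with hg'
    have e1 : (p ^ (k + 1)).mulVec g = (p ^ (k + 1)).mulVec g'
        + (p ^ (k + 1)).mulVec (a (k + 1)) := by
      rw [← Matrix.mulVec_add]
      congr 1
      funext w
      simp only [hg, hg', Pi.add_apply, Finset.sum_range_succ _ (k + 1)]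
      ring
    have step : (p.mulVec (accF p h a k)) z + M * ((p ^ (k + 1)).mulVec g) z
        ≤ M + N * Real.log (B / M) := by
      have : ∑ w, p z w * (accF p h a k w + M * ((p ^ k).mulVec g) w)
          ≤ ∑ w, p z w * (M + ((p ^ k).mulVec h) w * Real.log (B / M)) :=
        Finset.sum_le_sum fun w _ => mul_le_mul_of_nonneg_left (ih hs' w M hM hMB) (hp.1 _ _)
      have l : ∑ w, p z w * (accF p h a k w + M * ((p ^ k).mulVec g) w)
          = (p.mulVec (accF p h a k)) z + M * ((p ^ (k + 1)).mulVec g) z := by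
        rw [pow_succ', ← Matrix.mulVec_mulVec]
        simp only [Matrix.mulVec, dotProduct, mul_add, Finset.sum_add_distrib, Finset.mul_sum]
        congr 1
        refine Finset.sum_congr rfl fun w _ => Finset.sum_congr rfl fun v _ => by ring
      have r : ∑ w, p z w * (M + ((p ^ k).mulVec h) w * Real.log (B / M))
          = M + N * Real.log (B / M) := by
        rw [hN, pow_succ', ← Matrix.mulVec_mulVec]
        simp only [mul_add, Finset.sum_add_distrib, ← Finset.sum_mul, hp.2, one_mul, ← mul_assoc]
        rfl
      rw [l, r] at this
      exact this
    have e2 := congrFun e1 z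
    rw [Pi.add_apply] at e2
    have n1 : 0 ≤ ((p ^ (k + 1)).mulVec g') z :=
      powVec_nonneg hp _ (fun w => sub_nonneg.2 (hs w)) z
    have n2 : 0 ≤ ((p ^ (k + 1)).mulVec (a (k + 1))) z := powVec_nonneg hp _ (ha _) z
    have m1 := mul_le_mul_of_nonneg_right (le_max_left m N) n1
    have m2 := mul_le_mul_of_nonneg_right (le_max_right m N) n2
    rw [e2, mul_add] at step
    simp only [accF]
    rw [← hN]
    linarith

lemma selfadj {p : Matrix S S ℝ} {d : S → ℝ} (hd : ∀ a b, d a * p a b = d b * p b a) (k : ℕ)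
    (f g : S → ℝ) :
    ∑ z, d z * (((p ^ k).mulVec f) z * g z) = ∑ z, d z * (f z * ((p ^ k).mulVec g) z) := by
  have one : ∀ f g : S → ℝ,
      ∑ z, d z * ((p.mulVec f) z * g z) = ∑ z, d z * (f z * (p.mulVec g) z) := by
    intro f g
    simp only [Matrix.mulVec, dotProduct, Finset.mul_sum, Finset.sum_mul]
    rw [Finset.sum_comm]
    refine Finset.sum_congr rfl fun a _ => Finset.sum_congr rfl fun b _ => ?_
    linear_combination (f a * g b) * hd b a
  induction k generalizing f g with
  | zero => simp
  | succ k ih =>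
    rw [pow_succ', ← Matrix.mulVec_mulVec, one, ih, Matrix.mulVec_mulVec, ← pow_succ, pow_succ']

lemma stationary {p : Matrix S S ℝ} (hp : IsStochastic p) {d : S → ℝ}
    (hd : ∀ a b, d a * p a b = d b * p b a) (g : S → ℝ) :
    ∑ z, d z * (p.mulVec g) z = ∑ z, d z * g z := by
  have h := selfadj hd 1 g (fun _ => 1)
  have e : p.mulVec (fun _ => (1 : ℝ)) = fun _ => 1 := by
    funext z; simp [Matrix.mulVec, dotProduct, hp.2]
  simpa [e] using h

lemma sum_accF {p : Matrix S S ℝ} (hp : IsStochastic p) {d : S → ℝ}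
    (hd : ∀ a b, d a * p a b = d b * p b a) (h : S → ℝ) (a : ℕ → S → ℝ) (k : ℕ) :
    ∑ z, d z * accF p h a k z
      = ∑ j ∈ range (k + 1), ∑ z, d z * (((p ^ (2 * j)).mulVec h) z * a j z) := by
  induction k with
  | zero => simp [accF]
  | succ k ih =>
    rw [Finset.sum_range_succ, ← ih]
    simp only [accF, mul_add, Finset.sum_add_distrib]
    rw [stationary hp hd, ← selfadj hd, Matrix.mulVec_mulVec, ← pow_add]
    congr 3
    ring_nf

lemma pow_rev {p : Matrix S S ℝ} {d : S → ℝ} (hd : ∀ a b, d a * p a b = d b * p b a) (k : ℕ)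
    (a b : S) : d a * (p ^ k) a b = d b * (p ^ k) b a := by
  have := selfadj hd k (Pi.single b 1) (Pi.single a 1)
  simpa [Pi.single_apply] using this

lemma stationary_pow {p : Matrix S S ℝ} (hp : IsStochastic p) {d : S → ℝ}
    (hd : ∀ a b, d a * p a b = d b * p b a) (k : ℕ) (g : S → ℝ) :
    ∑ z, d z * ((p ^ k).mulVec g) z = ∑ z, d z * g z := by
  induction k with
  | zero => simp
  | succ k ih => rw [pow_succ', ← Matrix.mulVec_mulVec, stationary hp hd, ih]

lemma even_bound {p : Matrix S S ℝ} (hp : IsStochastic p) {d : S → ℝ} (hd0 : ∀ a, 0 < d a)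
    (hd : ∀ a b, d a * p a b = d b * p b a) (x : S) (K : ℕ) (κ : S → ℕ) (hκ : ∀ z, κ z ≤ K) :
    ∑ z, (p ^ (2 * κ z)) x z ≤ 1 + Real.log ((∑ z, d z) / d x) := by
  set D := ∑ z, d z with hD
  have hxD : d x ≤ D := Finset.single_le_sum (fun z _ => (hd0 z).le) (Finset.mem_univ x)
  have hDpos : 0 < D := (hd0 x).trans_le hxD
  have hx := hd0 x
  set h : S → ℝ := Pi.single x (1 / d x) with hh
  set a : ℕ → S → ℝ := fun j z => if κ z = j then 1 else 0 with ha
  have h0 : ∀ z, 0 ≤ h z := by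
    intro z; simp only [hh, Pi.single_apply]; split_ifs <;> positivity
  have hB : ∀ z, h z ≤ 1 / d x := by
    intro z; simp only [hh, Pi.single_apply]; split_ifs
    · exact le_rfl
    · positivity
  have hsum : ∀ z, ∑ j ∈ range (K + 1), a j z = 1 := by
    intro z
    simp only [ha, Finset.sum_ite_eq, Finset.mem_range]
    rw [if_pos]; have := hκ z; omega
  have ha0 : ∀ k z, 0 ≤ a k z := by
    intro k z; simp only [ha]; split_ifs <;> norm_num
  have main : ∀ z, accF p h a K z
      ≤ 1 / D + ((p ^ K).mulVec h) z * Real.log (D / d x) := by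
    intro z
    have := accF_le hp (B := 1 / d x) (by positivity) h0 hB a ha0 K (fun z => (hsum z).le) z
      (1 / D) (by positivity) (one_div_le_one_div_of_le hx hxD)
    simp only [hsum, sub_self] at this
    have e : (p ^ K).mulVec (fun _ => (0 : ℝ)) = 0 := Matrix.mulVec_zero _
    rw [e] at this
    have e3 : 1 / d x / (1 / D) = D / d x := by field_simp
    rw [e3] at this
    simpa using this
  have total : ∑ z, d z * accF p h a K z ≤ 1 + Real.log (D / d x) := by
    calc _ ≤ ∑ z, d z * (1 / D + ((p ^ K).mulVec h) z * Real.log (D / d x)) :=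
          Finset.sum_le_sum fun z _ => mul_le_mul_of_nonneg_left (main z) (hd0 z).le
      _ = D * (1 / D) + (∑ z, d z * ((p ^ K).mulVec h) z) * Real.log (D / d x) := by
          simp only [mul_add, Finset.sum_add_distrib, ← mul_assoc, ← Finset.sum_mul]
          rw [← hD]
      _ = _ := by
          rw [stationary_pow hp hd]
          have : ∑ z, d z * h z = 1 := by
            simp [hh, Pi.single_apply, hx.ne']
          rw [this]
          field_simp
  refine le_trans (le_of_eq ?_) total
  rw [sum_accF hp hd, Finset.sum_comm]
  refine Finset.sum_congr rfl fun z _ => ?_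
  rw [Finset.sum_eq_single (κ z)]
  · have e : ((p ^ (2 * κ z)).mulVec h) z = (p ^ (2 * κ z)) z x * (1 / d x) := by
      simp [hh, Matrix.mulVec, dotProduct, Pi.single_apply]
    rw [e]
    have := pow_rev hd (2 * κ z) x z
    simp only [ha, if_true, mul_one]
    field_simp
    linarith
  · intro j _ hj
    simp [ha, hj.symm]
  · intro hj
    have := hκ z
    simp at hj
    omega

lemma hit_bound {p : Matrix S S ℝ} (hp : IsStochastic p) {d : S → ℝ} (hd0 : ∀ a, 0 < d a)
    (hd : ∀ a b, d a * p a b = d b * p b a) (x y : S) (t : ℕ) :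
    t * hitProbEq p x y t ≤ 2 * (1 + Real.log ((∑ z, d z) / d x)) := by
  rw [hitProbEq_eq]
  have hex : ∀ z, ∃ k, k ≤ t ∧ ∀ j ≤ t, (p ^ (2 * j)) x z ≤ (p ^ (2 * k)) x z := by
    intro z
    obtain ⟨k, hk, hk'⟩ := Finset.exists_max_image (range (t + 1))
      (fun j => (p ^ (2 * j)) x z) ⟨0, by simp⟩
    refine ⟨k, by simpa [Nat.lt_succ_iff] using hk, fun j hj => hk' j ?_⟩
    simpa [Nat.lt_succ_iff] using hj
  choose κ hκ hmax using hex
  have hE := even_bound hp hd0 hd x t κ hκ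
  set E : S → ℝ := fun z => (p ^ (2 * κ z)) x z with hEd
  have hE0 : ∀ z, 0 ≤ E z := fun z => pow_nonneg' hp _ _ _
  have hO0 : ∀ z, 0 ≤ ∑ w, E w * p w z := fun z =>
    Finset.sum_nonneg fun w _ => mul_nonneg (hE0 w) (hp.1 _ _)
  have h := mul_hitRec_le hp x y t (fun z => E z + ∑ w, E w * p w z) (by
    intro s hs z
    rcases Nat.even_or_odd' s with ⟨k, rfl | rfl⟩
    · exact (hmax z k (by omega)).trans (le_add_of_nonneg_right (hO0 z))
    · refine le_trans ?_ (le_add_of_nonneg_left (hE0 z))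
      rw [pow_succ, Matrix.mul_apply]
      exact Finset.sum_le_sum fun w _ =>
        mul_le_mul_of_nonneg_right (hmax w k (by omega)) (hp.1 _ _))
    (fun z => add_nonneg (hE0 z) (hO0 z))
  refine h.trans ?_
  rw [Finset.sum_add_distrib, Finset.sum_comm]
  simp only [← Finset.mul_sum, hp.2, mul_one]
  linarith

lemma graph_hit {V : Type*} [Fintype V] (G : SimpleGraph V)
    (hG : G.Connected) (hn : 2 ≤ Fintype.card V) (x y : V) (t : ℕ) (ht : 0 < t) :
    hitProbEq (walkMatrix G) x y t ≤ 4 * Real.exp 1 * Real.log (Fintype.card V) / t := by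
  have : Nontrivial V := Fintype.one_lt_card_iff_nontrivial.1 hn
  set d : V → ℝ := fun a => (Nat.card (G.neighborSet a) : ℝ) with hdd
  have hd1 : ∀ a, 1 ≤ d a := by
    intro a
    obtain ⟨b, hb⟩ := hG.preconnected.exists_adj_of_nontrivial a
    have : Nonempty (G.neighborSet a) := ⟨⟨b, hb⟩⟩
    have : 0 < Nat.card (G.neighborSet a) := Nat.card_pos
    simp only [hdd]
    exact_mod_cast this
  have hd0 : ∀ a, 0 < d a := fun a => zero_lt_one.trans_le (hd1 a)
  have hdn : ∀ a, d a ≤ Fintype.card V := by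
    intro a
    simp only [hdd]
    rw [← Nat.card_eq_fintype_card]
    exact_mod_cast Finite.card_subtype_le _
  have hp : IsStochastic (walkMatrix G) := by
    constructor
    · intro a b
      simp only [walkMatrix, Matrix.of_apply]
      split_ifs <;> positivity
    · intro a
      simp only [walkMatrix, Matrix.of_apply]
      rw [← Finset.sum_filter, Finset.sum_const, nsmul_eq_mul]
      have : (Finset.univ.filter (fun b => G.Adj a b)).card = Nat.card (G.neighborSet a) := by
        rw [Nat.card_eq_fintype_card, Fintype.card_subtype]
        rfl
      rw [this]
      exact mul_one_div_cancel (hd0 a).ne'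
  have hrev : ∀ a b, d a * walkMatrix G a b = d b * walkMatrix G b a := by
    intro a b
    simp only [walkMatrix, Matrix.of_apply, G.adj_comm b a]
    split_ifs
    · rw [mul_one_div_cancel (hd0 a).ne', mul_one_div_cancel (hd0 b).ne']
    · simp
  have h := hit_bound hp hd0 hrev x y t
  set n : ℝ := (Fintype.card V : ℝ) with hndef
  have hn2 : (2 : ℝ) ≤ n := by rw [hndef]; exact_mod_cast hn
  have hD : ∑ z, d z ≤ n * n := by
    calc _ ≤ ∑ _z : V, n := Finset.sum_le_sum fun z _ => hdn z
      _ = _ := by simp [hndef]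
  have hDpos : 0 < ∑ z, d z := Finset.sum_pos (fun z _ => hd0 z) ⟨x, Finset.mem_univ x⟩
  have hlog : Real.log ((∑ z, d z) / d x) ≤ 2 * Real.log n := by
    have : Real.log (n * n) = 2 * Real.log n := by
      rw [Real.log_mul (by positivity) (by positivity)]; ring
    rw [← this]
    apply Real.log_le_log (div_pos hDpos (hd0 x))
    exact (div_le_self hDpos.le (hd1 x)).trans hD
  have hl2 : Real.log 2 ≤ Real.log n := Real.log_le_log (by norm_num) hn2
  have hl : 0.69 ≤ Real.log n := by linarith [Real.log_two_gt_d9]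
  have he : 2.7 ≤ Real.exp 1 := by linarith [Real.exp_one_gt_d9]
  rw [le_div_iff₀ (by exact_mod_cast ht), mul_comm]
  nlinarith

end aux

/-- Theorem 2 for graphs: for simple random walk on a connected simple graph with
`n ≥ 2` vertices, `P_x(τ(y) = t) ≤ 4e log n / t` and `P_x(S_t) ≤ 4e n log n / t`. -/
theorem graph_surprise_bound {V : Type*} [Fintype V] (G : SimpleGraph V)
    (hG : G.Connected) (hn : 2 ≤ Fintype.card V) (x y : V) (t : ℕ) (ht : 0 < t) :
    hitProbEq (walkMatrix G) x y t ≤ 4 * Real.exp 1 * Real.log (Fintype.card V) / t ∧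
      surpriseProb (walkMatrix G) x t ≤
        4 * Real.exp 1 * (Fintype.card V : ℝ) * Real.log (Fintype.card V) / t := by
  refine ⟨graph_hit G hG hn x y t ht, ?_⟩
  rw [surprise_le]
  calc _ ≤ ∑ _y : V, 4 * Real.exp 1 * Real.log (Fintype.card V) / t :=
        Finset.sum_le_sum fun y _ => graph_hit G hG hn x y t ht
    _ = _ := by
        rw [Finset.sum_const, nsmul_eq_mul, Finset.card_univ]
        ring
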